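/- (q-analog of the hook length branching rule, equation (3).) For a Young diagram λ define the hook polynomial h_λ(q) := ∏_{□∈λ} q^{−l(□)} · (1 + q + ⋯ + q^{h(□)−1}), a nonzero element of the field ℚ(q) of rational functions in q. Then for every nonempty Young diagram μ, c_μ(q) / h_μ(q) = Σ_{λ : λ+□=μ} 1 / h_λ(q), where c_μ(q) = Σ_{□∈μ} q^{c(□)} is the content polynomial and the sum runs over all Young diagrams λ with λ + □ = μ. (At q = 1, multiplied by |μ|!, this is the branching rule for dimensions of irreducible representations of the symmetric group.) -/

import Mathlib

open Finset

/-- The content of a cell `(i, j)` (0-indexed) of a Young diagram: `j - i`. -/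
def cellContent (c : ℕ × ℕ) : ℤ := (c.2 : ℤ) - (c.1 : ℤ)

/-- The arm length of a cell: number of cells strictly to its right in its row. -/
def armLen (μ : YoungDiagram) (c : ℕ × ℕ) : ℕ := μ.rowLen c.1 - (c.2 + 1)

/-- The leg length of a cell: number of cells strictly below it in its column. -/
def legLen (μ : YoungDiagram) (c : ℕ × ℕ) : ℕ := μ.colLen c.2 - (c.1 + 1)

/-- The hook length of a cell: arm + leg + 1. -/
def hookLen (μ : YoungDiagram) (c : ℕ × ℕ) : ℕ := armLen μ c + legLen μ c + 1

/-- `AddCell l m` means `m` is obtained from `l` by adding exactly one cell. -/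
def AddCell (l m : YoungDiagram) : Prop := l.cells ⊆ m.cells ∧ m.card = l.card + 1

/-- The variable `q` of the field `ℚ(q)` of rational functions. -/
noncomputable def q : RatFunc ℚ := RatFunc.X

/-- The content polynomial `c_λ(q) = Σ_{□∈λ} q^{c(□)} ∈ ℚ(q)`. -/
noncomputable def contentPolyQ (μ : YoungDiagram) : RatFunc ℚ :=
  ∑ c ∈ μ.cells, q ^ cellContent c

/-- The hook polynomial `h_λ(q) = ∏_{□∈λ} q^{-l(□)}·(1 + q + ⋯ + q^{h(□)-1}) ∈ ℚ(q)`. -/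
noncomputable def hookPoly (l : YoungDiagram) : RatFunc ℚ :=
  ∏ c ∈ l.cells, q ^ (-(legLen l c : ℤ)) * ∑ k ∈ Finset.range (hookLen l c), q ^ k


lemma q_ne_zero : q ≠ 0 := RatFunc.X_ne_zero

lemma q_pow_ne_one {n : ℕ} (hn : 0 < n) : q ^ n ≠ 1 := by
  intro h
  have h2 : algebraMap (Polynomial ℚ) (RatFunc ℚ) (Polynomial.X ^ n) =
      algebraMap (Polynomial ℚ) (RatFunc ℚ) 1 := by
    simpa [q, RatFunc.algebraMap_X] using h
  have h3 := RatFunc.algebraMap_injective ℚ h2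
  have h4 := congrArg Polynomial.natDegree h3
  simp at h4
  omega

lemma q_pow_inj {m n : ℕ} (h : q ^ m = q ^ n) : m = n := by
  have key : ∀ m n : ℕ, m < n → q ^ m ≠ q ^ n := by
    intro m n hmn h
    obtain ⟨k, rfl⟩ := Nat.exists_eq_add_of_lt hmn
    have h1 : q ^ m * q ^ (k + 1) = q ^ m * 1 := by rw [← pow_add, mul_one, h]; ring
    exact q_pow_ne_one (Nat.succ_pos k) (mul_left_cancel₀ (pow_ne_zero _ q_ne_zero) h1)
  rcases lt_trichotomy m n with h1 | h1 | h1
  · exact absurd h (key _ _ h1)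
  · exact h1
  · exact absurd h.symm (key _ _ h1)

lemma q_sub_one_ne : q - 1 ≠ 0 := by
  have := q_pow_ne_one (n := 1) one_pos
  rw [pow_one] at this
  exact sub_ne_zero.2 this

/-- q-number -/
noncomputable def br (n : ℕ) : RatFunc ℚ := ∑ k ∈ Finset.range n, q ^ k

lemma br_mul (n : ℕ) : br n * (q - 1) = q ^ n - 1 := geom_sum_mul q n

lemma br_eq (n : ℕ) : br n = (q ^ n - 1) / (q - 1) := by
  rw [eq_div_iff q_sub_one_ne, br_mul]

lemma br_ne {n : ℕ} (hn : 0 < n) : br n ≠ 0 := by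
  rw [br_eq]
  exact div_ne_zero (sub_ne_zero.2 (q_pow_ne_one hn)) q_sub_one_ne

/-- q-factorial -/
noncomputable def fac (n : ℕ) : RatFunc ℚ := ∏ k ∈ Finset.range n, br (k + 1)

lemma fac_succ (n : ℕ) : fac (n + 1) = fac n * br (n + 1) := Finset.prod_range_succ _ _

lemma fac_ne (n : ℕ) : fac n ≠ 0 := Finset.prod_ne_zero_iff.2 fun _ _ => br_ne (Nat.succ_pos _)

/-- truncated leg factor -/
noncomputable def ff (a c : ℕ → ℕ) (i d j : ℕ) : RatFunc ℚ :=
  q ^ (-((min (c j) (i + 1 + d) - (i + 1) : ℕ) : ℤ)) *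
    br (a i - j + (min (c j) (i + 1 + d) - (i + 1)))

lemma row_step1 (a c : ℕ → ℕ) (hac : ∀ i j, j < a i ↔ i < c j) (ha : Antitone a) (i d B : ℕ)
    (hB : B ≤ a (i + 1 + d)) :
    (∏ j ∈ range B, ff a c i (d + 1) j) * q ^ B * br (a i - B + d + 1) =
      (∏ j ∈ range B, ff a c i d j) * br (a i + d + 1) := by
  induction B with
  | zero => simp
  | succ B ih =>
    have ih := ih (by omega)
    have hm : a (i + 1 + d) ≤ a i := ha (by omega)
    have hc : i + 1 + d < c B := (hac _ _).1 (by omega)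
    have e1 : ff a c i (d + 1) B = q ^ (-((d + 1 : ℕ) : ℤ)) * br (a i - B + d + 1) := by
      unfold ff
      rw [show min (c B) (i + 1 + (d + 1)) - (i + 1) = d + 1 by omega]
      rfl
    have e2 : ff a c i d B = q ^ (-((d : ℕ) : ℤ)) * br (a i - (B + 1) + d + 1) := by
      unfold ff
      rw [show min (c B) (i + 1 + d) - (i + 1) = d by omega,
        show a i - B + d = a i - (B + 1) + d + 1 by omega]
    have e3 : q ^ (-((d : ℕ) : ℤ)) = q ^ (-((d + 1 : ℕ) : ℤ)) * q := by
      rw [← zpow_add_one₀ q_ne_zero]; congr 1; push_cast; ring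
    rw [prod_range_succ, prod_range_succ, e1, e2, e3, pow_succ]
    linear_combination (q ^ (-((d + 1 : ℕ) : ℤ)) * q * br (a i - (B + 1) + d + 1)) * ih

lemma row_step2 (a c : ℕ → ℕ) (hac : ∀ i j, j < a i ↔ i < c j) (ha : Antitone a) (i d : ℕ) :
    (∏ j ∈ range (a i), ff a c i (d + 1) j) * (q ^ (a (i + 1 + d)) *
      br (a i - a (i + 1 + d) + d + 1)) =
      (∏ j ∈ range (a i), ff a c i d j) * br (a i + d + 1) := by
  have hm : a (i + 1 + d) ≤ a i := ha (by omega)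
  have h1 := row_step1 a c hac ha i d _ le_rfl
  rw [← prod_range_mul_prod_Ico _ hm, ← prod_range_mul_prod_Ico (ff a c i d) hm]
  have h2 : ∏ j ∈ Ico (a (i + 1 + d)) (a i), ff a c i (d + 1) j =
      ∏ j ∈ Ico (a (i + 1 + d)) (a i), ff a c i d j := by
    refine prod_congr rfl fun j hj => ?_
    rw [mem_Ico] at hj
    have : ¬ (i + 1 + d < c j) := fun h => by
      have := (hac _ _).2 h
      omega
    unfold ff
    rw [show min (c j) (i + 1 + (d + 1)) = min (c j) (i + 1 + d) by omega]
  rw [h2]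
  linear_combination (∏ j ∈ Ico (a (i + 1 + d)) (a i), ff a c i d j) * h1

lemma row_prod (a c : ℕ → ℕ) (hac : ∀ i j, j < a i ↔ i < c j) (ha : Antitone a) (i d : ℕ) :
    (∏ j ∈ range (a i), ff a c i d j) *
      ∏ e ∈ range d, (q ^ (a (i + 1 + e)) * br (a i - a (i + 1 + e) + e + 1)) = fac (a i + d) := by
  induction d with
  | zero =>
    simp only [range_zero, prod_empty, mul_one, add_zero]
    unfold fac
    rw [← prod_range_reflect]
    refine prod_congr rfl fun j hj => ?_
    rw [mem_range] at hj
    unfold ff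
    rw [show min (c (a i - 1 - j)) (i + 1 + 0) - (i + 1) = 0 by omega]
    simp only [Nat.cast_zero, neg_zero, zpow_zero, one_mul, add_zero]
    congr 1
    omega
  | succ d ih =>
    rw [prod_range_succ, ← add_assoc, fac_succ, ← ih]
    have := row_step2 a c hac ha i d
    linear_combination (∏ e ∈ range d, (q ^ (a (i + 1 + e)) *
      br (a i - a (i + 1 + e) + e + 1))) * this

lemma prod_cells (μ : YoungDiagram) (n : ℕ) (hn : μ.colLen 0 ≤ n) (f : ℕ × ℕ → RatFunc ℚ) :
    ∏ c ∈ μ.cells, f c = ∏ i ∈ range n, ∏ j ∈ range (μ.rowLen i), f (i, j) := by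
  rw [prod_sigma']
  refine prod_bij' (fun c _ => ⟨c.1, c.2⟩) (fun s _ => (s.1, s.2)) ?_ ?_ ?_ ?_ ?_
  · rintro ⟨i, j⟩ h
    have h1 : (i, j) ∈ μ := h
    have h2 := YoungDiagram.mem_iff_lt_rowLen.1 h1
    have h3 := YoungDiagram.mem_iff_lt_colLen.1 h1
    have h4 := μ.colLen_anti 0 j (Nat.zero_le _)
    simp only [mem_sigma, mem_range]
    omega
  · rintro ⟨i, j⟩ h
    simp only [mem_sigma, mem_range] at h
    exact YoungDiagram.mem_iff_lt_rowLen.2 h.2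
  all_goals intros; rfl

lemma sum_cells (μ : YoungDiagram) (n : ℕ) (hn : μ.colLen 0 ≤ n) (f : ℕ × ℕ → RatFunc ℚ) :
    ∑ c ∈ μ.cells, f c = ∑ i ∈ range n, ∑ j ∈ range (μ.rowLen i), f (i, j) := by
  rw [sum_sigma']
  refine sum_bij' (fun c _ => ⟨c.1, c.2⟩) (fun s _ => (s.1, s.2)) ?_ ?_ ?_ ?_ ?_
  · rintro ⟨i, j⟩ h
    have h1 : (i, j) ∈ μ := h
    have h2 := YoungDiagram.mem_iff_lt_rowLen.1 h1
    have h3 := YoungDiagram.mem_iff_lt_colLen.1 h1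
    have h4 := μ.colLen_anti 0 j (Nat.zero_le _)
    simp only [mem_sigma, mem_range]
    omega
  · rintro ⟨i, j⟩ h
    simp only [mem_sigma, mem_range] at h
    exact YoungDiagram.mem_iff_lt_rowLen.2 h.2
  all_goals intros; rfl

/-- Vandermonde product -/
noncomputable def vd (n : ℕ) (x : ℕ → RatFunc ℚ) : RatFunc ℚ :=
  ∏ t ∈ range n, ∏ i ∈ range t, (x i - x t)

/-- shifted part -/
def sh (n : ℕ) (a : ℕ → ℕ) (i : ℕ) : ℕ := a i + (n - 1 - i)

/-- universal constant -/
noncomputable def cst (n : ℕ) : RatFunc ℚ :=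
  ∏ t ∈ range n, ∏ _i ∈ range t, (q ^ (n - 1 - t) * (q - 1))

lemma cst_ne (n : ℕ) : cst n ≠ 0 :=
  prod_ne_zero_iff.2 fun _ _ => prod_ne_zero_iff.2 fun _ _ =>
    mul_ne_zero (pow_ne_zero _ q_ne_zero) q_sub_one_ne

lemma hook_ne (l : YoungDiagram) : hookPoly l ≠ 0 :=
  prod_ne_zero_iff.2 fun _ _ => mul_ne_zero (zpow_ne_zero _ q_ne_zero) (br_ne (Nat.succ_pos _))

lemma hook_eq (μ : YoungDiagram) (n : ℕ) (hn : μ.colLen 0 ≤ n) :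
    hookPoly μ * vd n (fun i => q ^ sh n μ.rowLen i) =
      (∏ i ∈ range n, fac (sh n μ.rowLen i)) * cst n := by
  have hac : ∀ i j, j < μ.rowLen i ↔ i < μ.colLen j := fun i j => by
    rw [← YoungDiagram.mem_iff_lt_rowLen, YoungDiagram.mem_iff_lt_colLen]
  have ha : Antitone μ.rowLen := fun i j h => μ.rowLen_anti i j h
  have h1 : hookPoly μ = ∏ i ∈ range n, ∏ j ∈ range (μ.rowLen i),
      ff μ.rowLen μ.colLen i (n - 1 - i) j := by
    unfold hookPoly
    rw [prod_cells μ n hn]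
    refine prod_congr rfl fun i hi => prod_congr rfl fun j hj => ?_
    rw [mem_range] at hi hj
    have h4 := μ.colLen_anti 0 j (Nat.zero_le _)
    unfold ff br hookLen armLen legLen
    rw [show min (μ.colLen j) (i + 1 + (n - 1 - i)) = μ.colLen j by omega]
    congr 3
    simp only
    omega
  have h2 : vd n (fun i => q ^ sh n μ.rowLen i) = (∏ i ∈ range n, ∏ e ∈ range (n - 1 - i),
      (q ^ (μ.rowLen (i + 1 + e)) * br (μ.rowLen i - μ.rowLen (i + 1 + e) + e + 1))) * cst n := by
    have h3 : ∏ i ∈ range n, ∏ e ∈ range (n - 1 - i),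
      (q ^ (μ.rowLen (i + 1 + e)) * br (μ.rowLen i - μ.rowLen (i + 1 + e) + e + 1)) =
      ∏ t ∈ range n, ∏ i ∈ range t, (q ^ (μ.rowLen t) * br (μ.rowLen i - μ.rowLen t + (t - i))) := by
      symm
      rw [prod_comm' (t' := range n) (s' := fun t => Ico (t + 1) n)]
      · refine prod_congr rfl fun i hi => ?_
        rw [prod_Ico_eq_prod_range]
        rw [show n - 1 - i = n - (i + 1) by omega]
        refine prod_congr rfl fun e he => ?_
        congr 2
        omega
      · intro x y
        simp only [mem_range, mem_Ico]
        omega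
    rw [h3]
    unfold vd cst
    rw [← prod_mul_distrib]
    refine prod_congr rfl fun t ht => ?_
    rw [← prod_mul_distrib]
    refine prod_congr rfl fun i hi => ?_
    rw [mem_range] at hi ht
    have h5 := μ.rowLen_anti i t hi.le
    have h6 := br_mul (μ.rowLen i - μ.rowLen t + (t - i))
    have h7 : q ^ sh n μ.rowLen i = q ^ (μ.rowLen t) * q ^ (n - 1 - t) *
        q ^ (μ.rowLen i - μ.rowLen t + (t - i)) := by
      rw [← pow_add, ← pow_add]; congr 1; unfold sh; omega
    have h8 : q ^ sh n μ.rowLen t = q ^ (μ.rowLen t) * q ^ (n - 1 - t) := by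
      rw [← pow_add]; rfl
    simp only [h7, h8]
    linear_combination (-q ^ (μ.rowLen t) * q ^ (n - 1 - t)) * h6
  rw [h1, h2, ← mul_assoc, ← prod_mul_distrib]
  congr 1
  exact prod_congr rfl fun i _ => row_prod _ _ hac ha i _

lemma vd_update (x : ℕ → RatFunc ℚ) (y : RatFunc ℚ) (r n : ℕ) (hr : r < n) :
    vd n (Function.update x r y) * ∏ t ∈ (range n).erase r, (x t - x r) =
      vd n x * ∏ t ∈ (range n).erase r, (x t - y) := by
  induction n with
  | zero => omega
  | succ n ih =>
    have hs : ∀ z, vd (n + 1) z = vd n z * ∏ i ∈ range n, (z i - z n) := fun z =>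
      prod_range_succ _ _
    rw [hs, hs]
    rcases Nat.lt_succ_iff_lt_or_eq.1 hr with h | h
    · have ih := ih h
      have e : (range (n + 1)).erase r = insert n ((range n).erase r) := by
        ext k; simp only [mem_erase, mem_range, mem_insert]; omega
      have hn : n ∉ (range n).erase r := by simp
      have hrm : r ∈ range n := mem_range.2 h
      rw [e, prod_insert hn, prod_insert hn, ← mul_prod_erase _ _ hrm, ← mul_prod_erase _ _ hrm]
      rw [Function.update_self, Function.update_of_ne (by omega)]
      have e2 : ∏ i ∈ (range n).erase r, (Function.update x r y i - x n) =
          ∏ i ∈ (range n).erase r, (x i - x n) :=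
        prod_congr rfl fun i hi => by rw [Function.update_of_ne (ne_of_mem_erase hi)]
      rw [e2]
      linear_combination ((y - x n) * (∏ i ∈ (range n).erase r, (x i - x n)) * (x n - x r)) * ih
    · subst h
      have e : (range (r + 1)).erase r = range r := by
        ext k; simp only [mem_erase, mem_range]; omega
      have e1 : vd r (Function.update x r y) = vd r x := by
        refine prod_congr rfl fun t ht => prod_congr rfl fun i hi => ?_
        rw [mem_range] at ht hi
        rw [Function.update_of_ne (by omega), Function.update_of_ne (by omega)]
      have e2 : ∏ i ∈ range r, (Function.update x r y i - Function.update x r y r) =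
          ∏ i ∈ range r, (x i - y) := by
        refine prod_congr rfl fun i hi => ?_
        rw [mem_range] at hi
        rw [Function.update_of_ne (by omega), Function.update_self]
      rw [e, e1, e2]
      ring

open Polynomial in
lemma lagr {F : Type*} [Field F] (n : ℕ) (hn : 0 < n) (x : ℕ → F) (p : F) (hp : p ≠ 0)
    (hinj : ∀ i < n, ∀ j < n, x i = x j → i = j) (hx : ∀ i < n, x i ≠ 0) :
    (∑ r ∈ Finset.range n, (x r - 1) *
      ∏ t ∈ (Finset.range n).erase r, ((x t - p * x r) / (x t - x r))) * (p - 1) =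
      p ^ n * (∑ i ∈ Finset.range n, x i) - p ^ (n - 1) * (∑ i ∈ Finset.range n, x i) - p ^ n + 1 := by
  set A : F[X] := ∏ j ∈ Finset.range n, (X - C (p⁻¹ * x j)) with hA
  set B : F[X] := ∏ j ∈ Finset.range n, (X - C (x j)) with hB
  set P : F[X] := C (p ^ n) * (X * (A - B) - A) with hP
  set v : ℕ → F := Function.update x n 0 with hv
  have hvn : v n = 0 := Function.update_self ..
  have hvi : ∀ i < n, v i = x i := fun i hi => Function.update_of_ne (by omega) ..
  have mA : A.Monic := monic_prod_of_monic _ _ fun i _ => monic_X_sub_C _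
  have mB : B.Monic := monic_prod_of_monic _ _ fun i _ => monic_X_sub_C _
  have dA : A.natDegree = n := by
    rw [hA, natDegree_prod_of_monic _ _ fun i _ => monic_X_sub_C _]; simp [-map_mul]
  have dB : B.natDegree = n := by rw [hB, natDegree_prod_of_monic _ _ fun i _ => monic_X_sub_C _]; simp
  have cA : A.coeff (n - 1) = - ∑ j ∈ Finset.range n, p⁻¹ * x j := by
    have := prod_X_sub_C_coeff_card_pred (Finset.range n) (fun j => p⁻¹ * x j) (by simpa using hn)
    rwa [Finset.card_range] at this
  have cB : B.coeff (n - 1) = - ∑ j ∈ Finset.range n, x j := by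
    have := prod_X_sub_C_coeff_card_pred (Finset.range n) (fun j => x j) (by simpa using hn)
    rwa [Finset.card_range] at this
  have cA' : A.coeff n = 1 := by rw [← dA]; exact mA
  have cB' : B.coeff n = 1 := by rw [← dB]; exact mB
  have cP : P.coeff n = p ^ n * ((∑ j ∈ Finset.range n, x j) - p⁻¹ * (∑ j ∈ Finset.range n, x j) - 1) := by
    rw [hP, coeff_C_mul, coeff_sub, cA']
    obtain ⟨m, rfl⟩ : ∃ m, n = m + 1 := ⟨n - 1, by omega⟩
    rw [coeff_X_mul, coeff_sub]
    simp only [Nat.add_sub_cancel] at cA cB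
    rw [cA, cB, ← Finset.mul_sum]
    ring
  have dP : P.degree < #(Finset.range (n + 1)) := by
    rw [Finset.card_range, degree_lt_iff_coeff_zero]
    intro k hk
    obtain ⟨m, rfl⟩ : ∃ m, k = m + 1 := ⟨k - 1, by omega⟩
    rw [hP, coeff_C_mul, coeff_sub, coeff_X_mul, coeff_sub,
      coeff_eq_zero_of_natDegree_lt (p := A) (n := m + 1) (by omega)]
    rcases Nat.lt_or_ge n m with h | h
    · rw [coeff_eq_zero_of_natDegree_lt (p := A) (n := m) (by omega),
        coeff_eq_zero_of_natDegree_lt (p := B) (n := m) (by omega)]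
      simp
    · have : m = n := by omega
      rw [this, cA', cB']; simp
  have injv : Set.InjOn v (Finset.range (n + 1)) := by
    intro i hi j hj hij
    simp only [Finset.coe_range, Set.mem_Iio] at hi hj
    rcases Nat.lt_succ_iff_lt_or_eq.1 hi with h | h <;>
      rcases Nat.lt_succ_iff_lt_or_eq.1 hj with h' | h'
    · rw [hvi i h, hvi j h'] at hij
      exact hinj _ h _ h' hij
    · rw [hvi i h, h', hvn] at hij
      exact absurd hij (hx _ h)
    · rw [hvi j h', h, hvn] at hij
      exact absurd hij.symm (hx _ h')
    · omega
  have main := Lagrange.coeff_eq_sum injv dP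
  rw [Finset.card_range, Nat.add_sub_cancel, cP, Finset.sum_range_succ] at main
  have evA : ∀ z, p ^ n * A.eval z = ∏ j ∈ Finset.range n, (p * z - x j) := by
    intro z
    rw [hA, eval_prod]
    have hc : p ^ n = ∏ _j ∈ Finset.range n, p := by rw [Finset.prod_const, Finset.card_range]
    rw [hc, ← Finset.prod_mul_distrib]
    refine Finset.prod_congr rfl fun j _ => ?_
    simp only [eval_sub, eval_X, eval_C]
    field_simp
  have last : P.eval (v n) / ∏ j ∈ (Finset.range (n + 1)).erase n, (v n - v j) = -1 := by
    have e : (Finset.range (n + 1)).erase n = Finset.range n := by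
      ext k; simp only [Finset.mem_erase, Finset.mem_range]; omega
    have e2 : P.eval (v n) = - ∏ j ∈ Finset.range n, (v n - v j) := by
      have := evA 0
      rw [hvn, hP]
      simp only [eval_mul, eval_sub, eval_C, eval_X, zero_mul, zero_sub, mul_neg, this]
      congr 1
      refine Finset.prod_congr rfl fun j hj => ?_
      rw [hvi j (Finset.mem_range.1 hj)]; ring
    rw [e, e2, neg_div, div_self]
    refine Finset.prod_ne_zero_iff.2 fun j hj => ?_
    rw [hvn, hvi j (Finset.mem_range.1 hj), zero_sub]
    exact neg_ne_zero.2 (hx _ (Finset.mem_range.1 hj))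
  have term : ∀ r ∈ Finset.range n,
      P.eval (v r) / ∏ j ∈ (Finset.range (n + 1)).erase r, (v r - v j) =
      ((x r - 1) * ∏ t ∈ (Finset.range n).erase r, ((x t - p * x r) / (x t - x r))) * (p - 1) := by
    intro r hr
    have hr' := Finset.mem_range.1 hr
    have e : (Finset.range (n + 1)).erase r = insert n ((Finset.range n).erase r) := by
      ext k; simp only [Finset.mem_erase, Finset.mem_range, Finset.mem_insert]; omega
    have hn : n ∉ (Finset.range n).erase r := by simp
    have eB : B.eval (x r) = 0 := by
      rw [hB, eval_prod]
      exact Finset.prod_eq_zero hr (by simp)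
    have e2 : P.eval (v r) = (x r - 1) * ((p * x r - x r) *
        ∏ j ∈ (Finset.range n).erase r, (p * x r - x j)) := by
      rw [hvi r hr', Finset.mul_prod_erase _ (fun j => p * x r - x j) hr, ← evA, hP]
      simp only [eval_mul, eval_sub, eval_C, eval_X, eB]
      ring
    have e3 : ∏ t ∈ (Finset.range n).erase r, ((x t - p * x r) / (x t - x r)) =
        (∏ j ∈ (Finset.range n).erase r, (p * x r - x j)) /
          ∏ j ∈ (Finset.range n).erase r, (v r - v j) := by
      rw [← Finset.prod_div_distrib]
      refine Finset.prod_congr rfl fun j hj => ?_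
      rw [hvi r hr', hvi j (Finset.mem_range.1 (Finset.mem_of_mem_erase hj)),
        ← neg_sub, ← neg_sub (x r), neg_div_neg_eq]
    rw [e, Finset.prod_insert hn, e2, e3, hvn, hvi r hr', sub_zero]
    have := hx r hr'
    field_simp
  rw [Finset.sum_congr rfl term, last, ← Finset.sum_mul] at main
  have hpn : p ^ n * p⁻¹ = p ^ (n - 1) := by
    obtain ⟨m, rfl⟩ : ∃ m, n = m + 1 := ⟨n - 1, by omega⟩
    rw [Nat.add_sub_cancel, pow_succ]; field_simp
  linear_combination -main - (∑ j ∈ Finset.range n, x j) * hpn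

/-- term of the sum over rows -/
noncomputable def tt (n : ℕ) (a : ℕ → ℕ) (r : ℕ) : RatFunc ℚ :=
  br (sh n a r) * ∏ t ∈ (range n).erase r,
    ((q ^ sh n a t - q⁻¹ * q ^ sh n a r) / (q ^ sh n a t - q ^ sh n a r))

lemma sh_inj (n : ℕ) (a : ℕ → ℕ) (ha : Antitone a) :
    ∀ i < n, ∀ j < n, q ^ sh n a i = q ^ sh n a j → i = j := by
  intro i hi j hj h
  have h := q_pow_inj h
  unfold sh at h
  rcases lt_trichotomy i j with h1 | h1 | h1
  · have := ha h1.le; omega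
  · exact h1
  · have := ha h1.le; omega

lemma content_eq (μ : YoungDiagram) (n : ℕ) (hn : μ.colLen 0 ≤ n) (hpos : 0 < n) :
    contentPolyQ μ = ∑ r ∈ range n, tt n μ.rowLen r := by
  have ha : Antitone μ.rowLen := fun i j h => μ.rowLen_anti i j h
  have h0 := q_ne_zero
  have h1 := q_sub_one_ne
  have key := lagr n hpos (fun i => q ^ sh n μ.rowLen i) q⁻¹ (inv_ne_zero q_ne_zero)
    (sh_inj n _ ha) (fun i _ => pow_ne_zero _ q_ne_zero)
  have e1 : (∑ r ∈ range n, tt n μ.rowLen r) * (q - 1) = ∑ r ∈ Finset.range n,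
      (q ^ sh n μ.rowLen r - 1) * ∏ t ∈ (Finset.range n).erase r,
        ((q ^ sh n μ.rowLen t - q⁻¹ * q ^ sh n μ.rowLen r) /
          (q ^ sh n μ.rowLen t - q ^ sh n μ.rowLen r)) := by
    rw [sum_mul]
    refine sum_congr rfl fun r _ => ?_
    rw [← br_mul]; unfold tt; ring
  have e2 : contentPolyQ μ * (q - 1) =
      q⁻¹ ^ (n - 1) * (∑ i ∈ range n, q ^ sh n μ.rowLen i) - ∑ i ∈ range n, q⁻¹ ^ i := by
    unfold contentPolyQ
    rw [sum_cells μ n hn, sum_mul, mul_sum, ← sum_sub_distrib]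
    refine sum_congr rfl fun i hi => ?_
    rw [mem_range] at hi
    have e3 : ∑ j ∈ range (μ.rowLen i), q ^ cellContent (i, j) = q⁻¹ ^ i * br (μ.rowLen i) := by
      unfold br
      rw [mul_sum]
      refine sum_congr rfl fun j _ => ?_
      unfold cellContent
      rw [zpow_sub₀ h0, zpow_natCast, zpow_natCast, inv_pow]
      field_simp
    rw [e3, mul_assoc, br_mul]
    have e4 : q⁻¹ ^ (n - 1) * q ^ sh n μ.rowLen i = q⁻¹ ^ i * q ^ μ.rowLen i := by
      unfold sh
      rw [show q⁻¹ ^ (n - 1) = q⁻¹ ^ i * q⁻¹ ^ (n - 1 - i) by rw [← pow_add]; congr 1; omega,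
        pow_add, inv_pow q (n - 1 - i)]
      field_simp
    rw [e4]; ring
  have e5 := geom_sum_mul q⁻¹ n
  have hq1 : q⁻¹ - 1 ≠ 0 := by
    intro h
    apply h1
    have : q⁻¹ = 1 := sub_eq_zero.1 h
    rw [inv_eq_one.1 this, sub_self]
  have e6 : q⁻¹ ^ n = q⁻¹ ^ (n - 1) * q⁻¹ := by rw [← pow_succ]; congr 1; omega
  refine mul_right_cancel₀ h1 (mul_right_cancel₀ hq1 ?_)
  rw [e1]
  refine Eq.trans ?_ key.symm
  rw [e2]
  linear_combination -e5 - (∑ i ∈ range n, q ^ sh n μ.rowLen i) * e6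

lemma tt_zero (μ : YoungDiagram) (n r : ℕ) (hr : r < n) (hn : μ.colLen 0 ≤ n)
    (h : ¬ μ.rowLen (r + 1) < μ.rowLen r) : tt n μ.rowLen r = 0 := by
  have h1 := μ.rowLen_anti r (r + 1) (Nat.le_succ _)
  have h2 : μ.rowLen n = 0 := by
    by_contra h3
    have h4 : (n, 0) ∈ μ := YoungDiagram.mem_iff_lt_rowLen.2 (Nat.pos_of_ne_zero h3)
    have h5 := YoungDiagram.mem_iff_lt_colLen.1 h4
    omega
  unfold tt
  rcases Nat.lt_or_ge (r + 1) n with h3 | h3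
  · refine mul_eq_zero_of_right _ (prod_eq_zero (i := r + 1) (by simp [h3]) ?_)
    have : sh n μ.rowLen r = sh n μ.rowLen (r + 1) + 1 := by unfold sh; omega
    rw [this, pow_succ]
    have := q_ne_zero
    field_simp
    simp
  · have h4 : r + 1 = n := by omega
    have : sh n μ.rowLen r = 0 := by rw [h4] at h; unfold sh; omega
    rw [this]
    simp [br]

lemma ratio (μ l : YoungDiagram) (n r : ℕ) (hr : r < n) (hn : μ.colLen 0 ≤ n)
    (hl : l.colLen 0 ≤ n) (hpos : 0 < μ.rowLen r)
    (hrow : l.rowLen = Function.update μ.rowLen r (μ.rowLen r - 1)) :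
    1 / hookPoly l = tt n μ.rowLen r / hookPoly μ := by
  have h0 := q_ne_zero
  have ha : Antitone μ.rowLen := fun i j h => μ.rowLen_anti i j h
  have hm := hook_eq μ n hn
  have hL := hook_eq l n hl
  have hsr : sh n l.rowLen r + 1 = sh n μ.rowLen r := by
    unfold sh; rw [hrow, Function.update_self]; omega
  have hst : ∀ t, t ≠ r → sh n l.rowLen t = sh n μ.rowLen t := fun t ht => by
    unfold sh; rw [hrow, Function.update_of_ne ht]
  have hx : (fun i => q ^ sh n l.rowLen i) =
      Function.update (fun i => q ^ sh n μ.rowLen i) r (q⁻¹ * q ^ sh n μ.rowLen r) := by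
    funext i
    by_cases hi : i = r
    · subst hi
      rw [Function.update_self, ← hsr, pow_succ]; field_simp
    · rw [Function.update_of_ne hi, hst i hi]
  have hv := vd_update (fun i => q ^ sh n μ.rowLen i) (q⁻¹ * q ^ sh n μ.rowLen r) r n hr
  rw [← hx] at hv
  have hf : ∏ i ∈ range n, fac (sh n μ.rowLen i) =
      (∏ i ∈ range n, fac (sh n l.rowLen i)) * br (sh n μ.rowLen r) := by
    rw [← mul_prod_erase _ _ (mem_range.2 hr), ← mul_prod_erase _ _ (mem_range.2 hr), ← hsr, fac_succ,
      prod_congr rfl fun t ht => by rw [← hst t (ne_of_mem_erase ht)]]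
    ring
  have hfne : ∀ a : ℕ → ℕ, ∏ i ∈ range n, fac (sh n a i) ≠ 0 := fun a =>
    prod_ne_zero_iff.2 fun _ _ => fac_ne _
  have hD : ∏ t ∈ (range n).erase r, (q ^ sh n μ.rowLen t - q ^ sh n μ.rowLen r) ≠ 0 := by
    refine prod_ne_zero_iff.2 fun t ht h => ?_
    exact ne_of_mem_erase ht (sh_inj n _ ha t (mem_range.1 (mem_of_mem_erase ht)) r hr
      (sub_eq_zero.1 h))
  have hvm : vd n (fun i => q ^ sh n μ.rowLen i) ≠ 0 := by
    intro h
    rw [h, mul_zero] at hm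
    exact mul_ne_zero (hfne _) (cst_ne n) hm.symm
  have hvl : vd n (fun i => q ^ sh n l.rowLen i) ≠ 0 := by
    intro h
    rw [h, mul_zero] at hL
    exact mul_ne_zero (hfne _) (cst_ne n) hL.symm
  unfold tt
  rw [prod_div_distrib]
  rw [div_eq_div_iff (hook_ne _) (hook_ne _), one_mul]
  generalize (∏ t ∈ (range n).erase r, (q ^ sh n μ.rowLen t - q ^ sh n μ.rowLen r)) = D at *
  generalize (∏ t ∈ (range n).erase r, (q ^ sh n μ.rowLen t - q⁻¹ * q ^ sh n μ.rowLen r)) = N at *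
  generalize vd n (fun i => q ^ sh n μ.rowLen i) = Vm at *
  generalize vd n (fun i => q ^ sh n l.rowLen i) = Vl at *
  rw [hf] at hm
  generalize (∏ i ∈ range n, fac (sh n l.rowLen i)) = G at *
  field_simp
  refine mul_right_cancel₀ (mul_ne_zero hvl hvm) ?_
  linear_combination Vl * D * hm - br (sh n μ.rowLen r) * N * Vm * hL + G * cst n * br (sh n μ.rowLen r) * hv

open Classical in
/-- remove the last cell of row r (if it is a corner) -/
noncomputable def remc (μ : YoungDiagram) (r : ℕ) : YoungDiagram :=
  if h : μ.rowLen (r + 1) < μ.rowLen r then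
    ⟨μ.cells.erase (r, μ.rowLen r - 1), by
      rintro ⟨i, j⟩ ⟨i', j'⟩ hle hmem
      simp only [coe_erase, Set.mem_sdiff, mem_coe, Set.mem_singleton_iff,
        YoungDiagram.mem_cells] at hmem ⊢
      obtain ⟨h1, h2⟩ := hmem
      obtain ⟨h3, h4⟩ := hle
      simp only at h3 h4
      refine ⟨μ.up_left_mem h3 h4 h1, fun he => h2 ?_⟩
      rw [Prod.mk.injEq] at he
      obtain ⟨rfl, rfl⟩ := he
      have h5 := YoungDiagram.mem_iff_lt_rowLen.1 h1
      have h6 : i = i' := by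
        by_contra h7
        have := μ.rowLen_anti (i' + 1) i (by omega)
        omega
      subst h6
      rw [Prod.mk.injEq]
      omega⟩
  else ⊥

lemma remc_cells (μ : YoungDiagram) (r : ℕ) (h : μ.rowLen (r + 1) < μ.rowLen r) :
    (remc μ r).cells = μ.cells.erase (r, μ.rowLen r - 1) := by
  unfold remc; rw [dif_pos h]

lemma last_mem (μ : YoungDiagram) (r : ℕ) (h : μ.rowLen (r + 1) < μ.rowLen r) :
    (r, μ.rowLen r - 1) ∈ μ.cells :=
  YoungDiagram.mem_iff_lt_rowLen.2 (by omega)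

lemma remc_rowLen (μ : YoungDiagram) (r : ℕ) (h : μ.rowLen (r + 1) < μ.rowLen r) :
    (remc μ r).rowLen = Function.update μ.rowLen r (μ.rowLen r - 1) := by
  funext i
  refine eq_of_forall_lt_iff fun j => ?_
  rw [← YoungDiagram.mem_iff_lt_rowLen, ← YoungDiagram.mem_cells, remc_cells μ r h, mem_erase,
    YoungDiagram.mem_cells, YoungDiagram.mem_iff_lt_rowLen]
  by_cases hi : i = r
  · subst hi
    rw [Function.update_self, ne_eq, Prod.mk.injEq]
    omega
  · rw [Function.update_of_ne hi, ne_eq, Prod.mk.injEq]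
    tauto

lemma remc_addCell (μ : YoungDiagram) (r : ℕ) (h : μ.rowLen (r + 1) < μ.rowLen r) :
    AddCell (remc μ r) μ := by
  refine ⟨?_, ?_⟩
  · rw [remc_cells μ r h]; exact erase_subset _ _
  · change #μ.cells = #(remc μ r).cells + 1
    rw [remc_cells μ r h, card_erase_add_one (last_mem μ r h)]

lemma colLen_le_of_addCell {l μ : YoungDiagram} (h : AddCell l μ) : l.colLen 0 ≤ μ.colLen 0 := by
  by_contra! hlt
  have h1 : (μ.colLen 0, 0) ∈ l := YoungDiagram.mem_iff_lt_colLen.2 hlt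
  have h2 : (μ.colLen 0, 0) ∈ μ := h.1 h1
  exact absurd (YoungDiagram.mem_iff_lt_colLen.1 h2) (lt_irrefl _)

lemma addCell_exists {l μ : YoungDiagram} (h : AddCell l μ) :
    ∃ r, r < μ.colLen 0 ∧ μ.rowLen (r + 1) < μ.rowLen r ∧ remc μ r = l := by
  obtain ⟨hsub, hcard⟩ := h
  have hcard : #μ.cells = #l.cells + 1 := hcard
  have h1 : #(μ.cells \ l.cells) = 1 := by rw [card_sdiff_of_subset hsub]; omega
  obtain ⟨⟨r, s⟩, hc⟩ := card_eq_one.1 h1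
  have hmem : ∀ c : ℕ × ℕ, c ∈ μ.cells → c ≠ (r, s) → c ∈ l.cells := by
    intro c hcm hne
    by_contra hcl
    have : c ∈ μ.cells \ l.cells := mem_sdiff.2 ⟨hcm, hcl⟩
    rw [hc, mem_singleton] at this
    exact hne this
  have hrs : (r, s) ∈ μ.cells \ l.cells := by rw [hc]; exact mem_singleton_self _
  obtain ⟨hrs1, hrs2⟩ := mem_sdiff.1 hrs
  have h2 : s < μ.rowLen r := YoungDiagram.mem_iff_lt_rowLen.1 hrs1
  have h3 : s = μ.rowLen r - 1 := by
    by_contra h4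
    have h5 : (r, s + 1) ∈ l := hmem _ (YoungDiagram.mem_iff_lt_rowLen.2 (by omega)) (by simp)
    exact hrs2 (l.up_left_mem le_rfl (Nat.le_succ s) h5)
  have h4 : μ.rowLen (r + 1) < μ.rowLen r := by
    by_contra h4
    have h5 : (r + 1, s) ∈ l := hmem _ (YoungDiagram.mem_iff_lt_rowLen.2 (by omega)) (by simp)
    exact hrs2 (l.up_left_mem (Nat.le_succ r) le_rfl h5)
  refine ⟨r, ?_, h4, ?_⟩
  · have := YoungDiagram.mem_iff_lt_colLen.1 (show (r, s) ∈ μ from hrs1)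
    exact this.trans_le (μ.colLen_anti 0 s (Nat.zero_le _))
  · ext c
    rw [remc_cells μ r h4, ← h3, mem_erase]
    constructor
    · rintro ⟨h5, h6⟩
      exact hmem c h6 h5
    · intro h5
      exact ⟨fun h6 => hrs2 (h6 ▸ h5), hsub h5⟩

/-- The q-analog of the hook length branching rule: `h_λ(q)` is nonzero, and for every
nonempty Young diagram `μ`, `c_μ(q)/h_μ(q) = Σ_{λ+□=μ} 1/h_λ(q)`. -/
theorem weighted_hook_length_branching_rule :
    (∀ l : YoungDiagram, hookPoly l ≠ 0) ∧
    ∀ μ : YoungDiagram, μ.cells.Nonempty →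
      contentPolyQ μ / hookPoly μ =
        ∑ᶠ l ∈ {l : YoungDiagram | AddCell l μ}, 1 / hookPoly l := by
  classical
  refine ⟨hook_ne, fun μ hne => ?_⟩
  have hpos : 0 < μ.colLen 0 := by
    obtain ⟨⟨i, j⟩, hc⟩ := hne
    exact YoungDiagram.mem_iff_lt_colLen.1 (μ.up_left_mem (Nat.zero_le i) (Nat.zero_le j) hc)
  have hset : {l : YoungDiagram | AddCell l μ} =
      (((range (μ.colLen 0)).filter fun r => μ.rowLen (r + 1) < μ.rowLen r).image (remc μ) :
        Finset YoungDiagram) := by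
    ext l
    simp only [Set.mem_ofPred_eq, coe_image, Set.mem_image, mem_coe, mem_filter, mem_range]
    constructor
    · intro h
      obtain ⟨r, h1, h2, h3⟩ := addCell_exists h
      exact ⟨r, ⟨h1, h2⟩, h3⟩
    · rintro ⟨r, ⟨-, h2⟩, rfl⟩
      exact remc_addCell μ r h2
  rw [hset, finsum_mem_coe_finset, sum_image]
  · rw [content_eq μ _ le_rfl hpos, sum_div, sum_filter]
    refine sum_congr rfl fun r hr => ?_
    rw [mem_range] at hr
    split_ifs with h
    · exact (ratio μ _ _ r hr le_rfl (colLen_le_of_addCell (remc_addCell μ r h)) (by omega)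
        (remc_rowLen μ r h)).symm
    · rw [tt_zero μ _ r hr le_rfl h, zero_div]
  · intro r hr r' hr' heq
    simp only [coe_filter, Set.mem_ofPred_eq] at hr hr'
    by_contra hrr
    have h1 : (r, μ.rowLen r - 1) ∈ (remc μ r').cells := by
      rw [remc_cells μ r' hr'.2, mem_erase]
      refine ⟨fun h => hrr ?_, last_mem μ r hr.2⟩
      rw [Prod.mk.injEq] at h
      exact h.1
    rw [← heq, remc_cells μ r hr.2] at h1
    exact notMem_erase _ _ h1
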